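/- arXiv:2411.03163 — 2 statements merged into one kernel-verified Lean document; each statement's English description precedes it below -/
import Mathlib

section
/- Let H = S⁻ᵀDS⁻¹ be a Hamiltonian matrix with symplectic diagonalization (S symplectic, D = diag(d₁,d₁,…,d_m,d_m), all d_i > 0, d_max the largest d_i) and let V := (1/2)·S·diag(coth d₁, coth d₁,…, coth d_m, coth d_m)·Sᵀ be its covariance matrix. Then for every natural number l, ‖(2V − iΩ)⁻¹ − (1/2)·(Σ_{n=1}^{l} (2H·iΩ)ⁿ/n!)·(iΩ)‖∞ ≤ (‖S‖∞²/2)·(2 d_max)^{l+1}·e^{2 d_max}/(l+1)!. -/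
open Matrix

/-- The spectral norm (ℓ²→ℓ² operator norm, largest singular value) of a matrix. -/
noncomputable def spNorm {𝕜 : Type*} [RCLike 𝕜] {p q : Type*} [Fintype p] [Fintype q]
    [DecidableEq q] (A : Matrix p q 𝕜) : ℝ :=
  ‖LinearMap.toContinuousLinearMap (Matrix.toEuclideanLin A)‖

/-- Index set for `2m × 2m` matrices: the pair `(i, δ)` stands for the index `2i - δ`,
`(i, 0)` being the first index of the `i`-th pair and `(i, 1)` the second. -/
abbrev Idx (m : ℕ) := Fin m × Fin 2

/-- The standard symplectic form: block diagonal with `m` blocks `[[0,1],[-1,0]]`. -/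
def Omega (m : ℕ) : Matrix (Idx m) (Idx m) ℝ :=
  Matrix.of fun p q =>
    if p.1 = q.1 ∧ p.2 = 0 ∧ q.2 = 1 then 1
    else if p.1 = q.1 ∧ p.2 = 1 ∧ q.2 = 0 then -1 else 0

/-- The diagonal matrix `diag (d₁, d₁, …, d_m, d_m)`. -/
def pairDiag {m : ℕ} (d : Fin m → ℝ) : Matrix (Idx m) (Idx m) ℝ :=
  Matrix.diagonal fun p => d p.1

/-- Hyperbolic cotangent. -/
noncomputable def rcoth (x : ℝ) : ℝ := Real.cosh x / Real.sinh x

/-- A real matrix regarded as a complex matrix. -/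
def cplx {p q : Type*} (A : Matrix p q ℝ) : Matrix p q ℂ :=
  A.map (fun x => (x : ℂ))

section aux

open scoped Matrix.Norms.L2Operator

lemma aux_remainder {𝔸 : Type*} [NormedRing 𝔸] [NormedAlgebra ℂ 𝔸] [CompleteSpace 𝔸]
    (A : 𝔸) (x : ℝ) (hx : ‖A‖ ≤ x) (l : ℕ) :
    ‖NormedSpace.exp A - 1 - ∑ n ∈ Finset.Icc 1 l, ((n.factorial : ℂ))⁻¹ • A ^ n‖
      ≤ x ^ (l + 1) * Real.exp x / ((l + 1).factorial : ℝ) := by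
  have hx0 : 0 ≤ x := (norm_nonneg _).trans hx
  have h1 := NormedSpace.exp_series_hasSum_exp' (𝕂 := ℂ) A
  have h2 := (hasSum_nat_add_iff' (l + 1)).2 h1
  have h3 : ∑ n ∈ Finset.range (l + 1), ((n.factorial : ℂ))⁻¹ • A ^ n
      = 1 + ∑ n ∈ Finset.Icc 1 l, ((n.factorial : ℂ))⁻¹ • A ^ n := by
    rw [Finset.range_eq_Ico, Finset.sum_eq_sum_Ico_succ_bot (by omega)]
    simp only [Nat.factorial_zero, Nat.cast_one, inv_one, pow_zero, one_smul]
    congr 1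
  rw [h3, ← sub_sub] at h2
  have h4 : HasSum (fun n : ℕ => x ^ (l + 1) / ((l + 1).factorial : ℝ) * (x ^ n / (n.factorial : ℝ)))
      (x ^ (l + 1) / ((l + 1).factorial : ℝ) * Real.exp x) := by
    have := NormedSpace.expSeries_div_hasSum_exp x
    rw [← Real.exp_eq_exp_ℝ] at this
    exact this.mul_left _
  have h5 := h2.norm_le_of_bounded h4 (fun n => by
    rw [norm_smul, norm_inv, Complex.norm_natCast]
    have e1 : ‖A ^ (n + (l + 1))‖ ≤ x ^ (n + (l + 1)) :=
      (norm_pow_le' A (by omega)).trans (by gcongr)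
    have e2 : ((n.factorial : ℝ)) * ((l + 1).factorial : ℝ) ≤ ((n + (l + 1)).factorial : ℝ) := by
      exact_mod_cast Nat.le_of_dvd (Nat.factorial_pos _) (Nat.factorial_mul_factorial_dvd_factorial_add _ _)
    have p1 : (0 : ℝ) < n.factorial := by positivity
    have p2 : (0 : ℝ) < (l + 1).factorial := by positivity
    calc _ ≤ ((n.factorial : ℝ) * ((l + 1).factorial : ℝ))⁻¹ * x ^ (n + (l + 1)) := by gcongr
      _ = _ := by rw [pow_add]; field_simp)
  rw [div_mul_eq_mul_div] at h5
  exact h5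

lemma aux_exp_mul {𝔸 : Type*} [NormedRing 𝔸] [NormedAlgebra ℂ 𝔸] [CompleteSpace 𝔸]
    (A B P : 𝔸) (h : A * P = B * P) (hBP : B * P = P * B) :
    NormedSpace.exp A * P = NormedSpace.exp B * P := by
  have hn : ∀ n : ℕ, A ^ n * P = B ^ n * P := by
    intro n
    induction n with
    | zero => simp
    | succ k ih =>
      rw [pow_succ, mul_assoc, h, hBP, ← mul_assoc, ih, mul_assoc, ← hBP, ← mul_assoc, ← pow_succ]
  have h1 := (NormedSpace.exp_series_hasSum_exp' (𝕂 := ℂ) A).mul_right P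
  have h2 := (NormedSpace.exp_series_hasSum_exp' (𝕂 := ℂ) B).mul_right P
  refine h1.unique ?_
  convert h2 using 2 with n
  rw [smul_mul_assoc, smul_mul_assoc, hn]

lemma aux_inv {R : Type*} [Ring R] [Invertible (2 : R)] (C J Z P Q : R)
    (hJJ : J * J = 1) (hJP : J * P = P * J) (hJQ : J * Q = Q * J)
    (hZ1 : Z * (1 + J) = P * (1 + J)) (hZ2 : Z * (1 - J) = Q * (1 - J))
    (h1 : (C - 1) * P = C + 1) (h2 : (C + 1) * Q = C - 1) :
    (C - J) * (Z - 1) * J = 2 := by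
  have a1 : (C - J) * (Z - 1) * J * (1 + J) = 2 * (1 + J) := by
    have j1 : J * (1 + J) = 1 + J := by rw [mul_add, hJJ]; noncomm_ring
    calc _ = (C - J) * (Z * (1 + J) - (1 + J)) := by
          rw [mul_assoc, j1, mul_assoc, sub_mul Z, one_mul]
      _ = (C * P - J * P - C + J) * (1 + J) := by rw [hZ1]; noncomm_ring
      _ = (C * P - C) * (1 + J) - P * (J * (1 + J)) + J * (1 + J) := by
          rw [hJP]; noncomm_ring
      _ = ((C - 1) * P - (C - 1)) * (1 + J) := by rw [j1]; noncomm_ring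
      _ = _ := by rw [h1]; noncomm_ring
  have a2 : (C - J) * (Z - 1) * J * (1 - J) = 2 * (1 - J) := by
    have j1 : J * (1 - J) = -(1 - J) := by rw [mul_sub, hJJ]; noncomm_ring
    calc _ = -((C - J) * (Z * (1 - J) - (1 - J))) := by
          rw [mul_assoc, j1, mul_neg, mul_assoc, sub_mul Z, one_mul]
      _ = -((C * Q - J * Q - C + J) * (1 - J)) := by rw [hZ2]; noncomm_ring
      _ = -((C * Q - C) * (1 - J) - Q * (J * (1 - J)) + J * (1 - J)) := by
          rw [hJQ]; noncomm_ring
      _ = -(((C + 1) * Q - (C + 1)) * (1 - J)) := by rw [j1]; noncomm_ring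
      _ = _ := by rw [h2]; noncomm_ring
  have a3 : 2 * ((C - J) * (Z - 1) * J) = 2 * 2 := by
    calc _ = (C - J) * (Z - 1) * J * (1 + J) + (C - J) * (Z - 1) * J * (1 - J) := by
          rw [← mul_add]; rw [show (1 + J) + (1 - J) = (2 : R) by rw [← one_add_one_eq_two]; abel]
          rw [two_mul, mul_two]
      _ = _ := by
          rw [a1, a2, ← mul_add]; rw [show (1 + J) + (1 - J) = (2 : R) by rw [← one_add_one_eq_two]; abel]
  exact (isUnit_of_invertible (2 : R)).mul_left_cancel a3

lemma cplx_mul {m : ℕ} (A B : Matrix (Idx m) (Idx m) ℝ) : cplx (A * B) = cplx A * cplx B :=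
  Matrix.map_mul (f := Complex.ofRealHom)

lemma cplx_transpose {m : ℕ} (A : Matrix (Idx m) (Idx m) ℝ) : cplx Aᵀ = (cplx A)ᵀ := rfl

lemma cplx_conjTranspose {m : ℕ} (A : Matrix (Idx m) (Idx m) ℝ) : (cplx A)ᴴ = (cplx A)ᵀ := by
  ext i j; simp [cplx]

lemma Omega_sq (m : ℕ) : Omega m * Omega m = -1 := by
  ext ⟨i, a⟩ ⟨j, b⟩
  rw [Matrix.mul_apply, Fintype.sum_prod_type]
  simp only [Fin.sum_univ_two, Omega, Matrix.of_apply]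
  rw [Finset.sum_eq_single i]
  · by_cases h : i = j <;> fin_cases a <;> fin_cases b <;> simp [h]
  · intro k _ hk
    simp [hk.symm]
  · simp

lemma Omega_transpose (m : ℕ) : (Omega m)ᵀ = -Omega m := by
  ext ⟨i, a⟩ ⟨j, b⟩
  by_cases h : i = j
  · fin_cases a <;> fin_cases b <;> simp [Omega, h]
  · simp [Omega, h, Ne.symm h]

lemma Omega_pairDiag {m : ℕ} (d : Fin m → ℝ) :
    Omega m * pairDiag d = pairDiag d * Omega m := by
  ext ⟨i, a⟩ ⟨j, b⟩
  simp only [pairDiag, Matrix.mul_diagonal, Matrix.diagonal_mul]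
  by_cases h : i = j
  · subst h; ring
  · simp [Omega, h]

lemma cplx_norm_le {m : ℕ} (A : Matrix (Idx m) (Idx m) ℝ) : ‖cplx A‖ ≤ spNorm A := by
  have h0 : 0 ≤ spNorm A := norm_nonneg _
  rw [Matrix.l2_opNorm_def]
  refine ContinuousLinearMap.opNorm_le_bound _ h0 fun v => ?_
  refine (sq_le_sq₀ (by positivity) (by positivity)).mp ?_
  let x : EuclideanSpace ℝ (Idx m) := WithLp.toLp 2 fun i => (v i).re
  let y : EuclideanSpace ℝ (Idx m) := WithLp.toLp 2 fun i => (v i).im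
  let L := LinearMap.toContinuousLinearMap (Matrix.toEuclideanLin A)
  have hx : ‖L x‖ ≤ spNorm A * ‖x‖ := L.le_opNorm x
  have hy : ‖L y‖ ≤ spNorm A * ‖y‖ := L.le_opNorm y
  have hv : ‖v‖ ^ 2 = ‖x‖ ^ 2 + ‖y‖ ^ 2 := by
    rw [EuclideanSpace.norm_sq_eq, EuclideanSpace.norm_sq_eq, EuclideanSpace.norm_sq_eq,
      ← Finset.sum_add_distrib]
    refine Finset.sum_congr rfl fun i _ => ?_
    simp only [x, y, Real.norm_eq_abs, sq_abs, Complex.sq_norm, Complex.normSq_apply]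
    ring
  have hw : ‖(Matrix.toEuclideanLin.trans LinearMap.toContinuousLinearMap) (cplx A) v‖ ^ 2
      = ‖L x‖ ^ 2 + ‖L y‖ ^ 2 := by
    rw [EuclideanSpace.norm_sq_eq, EuclideanSpace.norm_sq_eq, EuclideanSpace.norm_sq_eq,
      ← Finset.sum_add_distrib]
    refine Finset.sum_congr rfl fun i _ => ?_
    have e : ((Matrix.toEuclideanLin.trans LinearMap.toContinuousLinearMap) (cplx A) v) i
        = ∑ j, (A i j : ℂ) * v j := rfl
    have e1 : L x i = ∑ j, A i j * (v j).re := rfl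
    have e2 : L y i = ∑ j, A i j * (v j).im := rfl
    rw [e, e1, e2, Complex.sq_norm, Complex.normSq_apply]
    simp only [Complex.re_sum, Complex.im_sum, Complex.re_ofReal_mul, Complex.im_ofReal_mul,
      Real.norm_eq_abs, sq_abs]
    ring
  rw [hw, mul_pow, hv, mul_add, ← mul_pow, ← mul_pow]
  gcongr

theorem statement4_aux {m : ℕ} (hm : 0 < m)
    (S : Matrix (Idx m) (Idx m) ℝ) (hS : S * Omega m * Sᵀ = Omega m)
    (d : Fin m → ℝ) (hd : ∀ i, 0 < d i)
    (dmax : ℝ) (hdmax_le : ∀ i, d i ≤ dmax) (hdmax_mem : ∃ i, d i = dmax)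
    (H : Matrix (Idx m) (Idx m) ℝ) (hH : H = (S⁻¹)ᵀ * pairDiag d * S⁻¹)
    (V : Matrix (Idx m) (Idx m) ℝ)
    (hV : V = (1/2 : ℝ) • (S * pairDiag (fun i => rcoth (d i)) * Sᵀ))
    (l : ℕ) :
    spNorm (((2 : ℂ) • cplx V - Complex.I • cplx (Omega m))⁻¹ -
        (1/2 : ℂ) •
          ((∑ n ∈ Finset.Icc 1 l,
              ((n.factorial : ℂ))⁻¹ • ((2 * Complex.I) • (cplx H * cplx (Omega m))) ^ n) *
            (Complex.I • cplx (Omega m))))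
      ≤ (spNorm S ^ 2 / 2) *
          ((2 * dmax) ^ (l + 1) * Real.exp (2 * dmax) / ((l + 1).factorial : ℝ)) := by
  obtain ⟨i0, hi0⟩ := hdmax_mem
  have hdm : 0 < dmax := hi0 ▸ hd i0
  set W := cplx (Omega m) with hW
  set J := Complex.I • W with hJ
  set K := cplx S with hK
  have hneg : ∀ A : Matrix (Idx m) (Idx m) ℝ, cplx (-A) = -cplx A := fun A => by
    ext i j; simp [cplx]
  have hone : cplx (1 : Matrix (Idx m) (Idx m) ℝ) = 1 := by
    ext i j; by_cases h : i = j <;> simp [cplx, h, Matrix.one_apply]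
  have hWW : W * W = -1 := by rw [hW, ← cplx_mul, Omega_sq, hneg, hone]
  have hWT : Wᵀ = -W := by rw [hW, ← cplx_transpose, Omega_transpose, hneg]
  have hJJ : J * J = 1 := by
    rw [hJ, smul_mul_smul_comm, hWW, Complex.I_mul_I]; simp
  have hJH : Jᴴ = J := by
    rw [hJ, Matrix.conjTranspose_smul, hW, cplx_conjTranspose, ← hW, hWT]; simp
  have hJT : Jᵀ = -J := by rw [hJ, Matrix.transpose_smul, hWT, smul_neg]
  have hJn : ‖J‖ ≤ 1 := by
    have h1 := Matrix.l2_opNorm_conjTranspose_mul_self J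
    rw [hJH, hJJ] at h1
    have h2 : ‖(1 : Matrix (Idx m) (Idx m) ℂ)‖ ≤ 1 := by
      rw [← Matrix.diagonal_one, Matrix.l2_opNorm_diagonal]
      exact (pi_norm_le_iff_of_nonneg zero_le_one).2 fun i => by simp
    nlinarith [norm_nonneg J]
  have hKJK : K * J * Kᵀ = J := by
    rw [hJ, mul_smul_comm, smul_mul_assoc, hK, hW, ← cplx_transpose, ← cplx_mul, ← cplx_mul, hS]
  -- the inverse of S
  set T := J * Kᵀ * J with hT
  have hKT : K * T = 1 := by rw [hT, ← mul_assoc, ← mul_assoc, hKJK, hJJ]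
  have hTK : T * K = 1 := mul_eq_one_comm.mp hKT
  have hTT : Tᵀ = J * K * J := by
    rw [hT, Matrix.transpose_mul, Matrix.transpose_mul, hJT, Matrix.transpose_transpose]
    noncomm_ring
  have hKTT : Kᵀ * Tᵀ = 1 := by rw [← Matrix.transpose_mul, hTK, Matrix.transpose_one]
  have hS2 : S * (-(Omega m) * Sᵀ * Omega m) = 1 := by
    rw [← mul_assoc, ← mul_assoc, mul_neg, neg_mul, hS, neg_mul, Omega_sq, neg_neg]
  have hSdet : IsUnit S.det := Matrix.isUnit_det_of_right_inverse hS2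
  have hTS : cplx S⁻¹ = T := by
    have h1 : K * cplx S⁻¹ = 1 := by rw [hK, ← cplx_mul, Matrix.mul_nonsing_inv _ hSdet, hone]
    calc cplx S⁻¹ = (T * K) * cplx S⁻¹ := by rw [hTK, one_mul]
      _ = T := by rw [mul_assoc, h1, mul_one]
  have hTJ : T * J = J * Kᵀ := by rw [hT, mul_assoc, hJJ, mul_one]
  have hJT2 : Kᵀ * J = J * T := by rw [hT, ← mul_assoc, ← mul_assoc, hJJ, one_mul]
  have hKn : ‖K‖ ≤ spNorm S := cplx_norm_le S
  have hKtn : ‖Kᵀ‖ ≤ spNorm S := by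
    rw [← cplx_conjTranspose, Matrix.l2_opNorm_conjTranspose]; exact hKn
  have hs0 : 0 ≤ spNorm S := norm_nonneg _
  have hsand : ∀ B : Matrix (Idx m) (Idx m) ℂ, ‖B‖ ≤ spNorm S → ‖J * B * J‖ ≤ spNorm S := by
    intro B hB
    calc ‖J * B * J‖ ≤ ‖J‖ * ‖B‖ * ‖J‖ :=
          (norm_mul_le _ _).trans (by gcongr; exact norm_mul_le _ _)
      _ ≤ 1 * spNorm S * 1 := by gcongr
      _ = _ := by ring
  have hTn : ‖T‖ ≤ spNorm S := hsand _ hKtn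
  have hTtn : ‖Tᵀ‖ ≤ spNorm S := hTT ▸ hsand _ hKn
  -- the normal form
  have hcd : ∀ f : Fin m → ℝ, cplx (pairDiag f) = Matrix.diagonal fun p => (f p.1 : ℂ) := by
    intro f
    ext i j; by_cases h : i = j <;> simp [cplx, pairDiag, Matrix.diagonal_apply, h]
  have hJd : ∀ f : Fin m → ℝ, J * cplx (pairDiag f) = cplx (pairDiag f) * J := by
    intro f
    rw [hJ, smul_mul_assoc, mul_smul_comm, hW, ← cplx_mul, ← cplx_mul, Omega_pairDiag]
  set C := cplx (pairDiag (fun i => rcoth (d i))) with hC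
  set X := cplx (pairDiag (fun i => 2 * d i)) with hX
  have hXneg : -X = cplx (pairDiag (fun i => -(2 * d i))) := by
    rw [hX, hcd, hcd, Matrix.diagonal_neg]; congr 1; ext p; simp
  have hexp : ∀ f : Fin m → ℝ, NormedSpace.exp (cplx (pairDiag f))
      = cplx (pairDiag fun i => Real.exp (f i)) := by
    intro f
    rw [hcd, hcd, Matrix.exp_diagonal]
    congr 1; ext p
    rw [Pi.coe_exp, Complex.ofReal_exp, Complex.exp_eq_exp_ℂ]
  set P := cplx (pairDiag (fun i => Real.exp (2 * d i))) with hP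
  set Q := cplx (pairDiag (fun i => Real.exp (-(2 * d i)))) with hQ
  set Z := NormedSpace.exp (X * J) with hZ
  have hJX : J * X = X * J := hJd _
  have hZ1 : Z * (1 + J) = P * (1 + J) := by
    rw [hP, ← hexp, hZ]
    apply aux_exp_mul
    · rw [← hX, mul_add, mul_assoc X J J, hJJ, mul_add, mul_one, mul_one, add_comm]
    · rw [← hX, mul_add, add_mul, hJX]; simp
  have hZ2 : Z * (1 - J) = Q * (1 - J) := by
    rw [hQ, ← hexp, hZ, ← hXneg]
    apply aux_exp_mul
    · rw [mul_sub, mul_assoc X J J, hJJ]; noncomm_ring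
    · rw [mul_sub, sub_mul, mul_neg J, hJX]; simp
  have hone2 : (1 : Matrix (Idx m) (Idx m) ℂ) = Matrix.diagonal fun _ => 1 := by simp
  have hsc : ∀ x : ℝ, 0 < x → (rcoth x - 1) * Real.exp (2 * x) = rcoth x + 1 ∧
      (rcoth x + 1) * Real.exp (-(2 * x)) = rcoth x - 1 := by
    intro x hx
    have hs : Real.exp x - Real.exp (-x) ≠ 0 := by
      have : Real.exp (-x) < Real.exp x := Real.exp_lt_exp.2 (by linarith)
      linarith
    have e0 : Real.exp x * Real.exp (-x) = 1 := by rw [← Real.exp_add]; simp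
    rw [rcoth, Real.cosh_eq, Real.sinh_eq,
      show 2 * x = x + x by ring, show -(x + x) = -x + -x by ring, Real.exp_add, Real.exp_add]
    generalize Real.exp x = a at *
    generalize Real.exp (-x) = b at *
    constructor
    · field_simp; linear_combination (2 * a) * e0
    · field_simp; linear_combination (2 * b) * e0
  have h1 : (C - 1) * P = C + 1 := by
    rw [hC, hP, hcd, hcd, hone2, Matrix.diagonal_sub, Matrix.diagonal_mul_diagonal,
      Matrix.diagonal_add]
    congr 1; ext p; exact_mod_cast (hsc (d p.1) (hd _)).1
  have h2 : (C + 1) * Q = C - 1 := by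
    rw [hC, hQ, hcd, hcd, hone2, Matrix.diagonal_sub, Matrix.diagonal_add,
      Matrix.diagonal_mul_diagonal]
    congr 1; ext p; exact_mod_cast (hsc (d p.1) (hd _)).2
  haveI : Invertible (2 : Matrix (Idx m) (Idx m) ℂ) :=
    ⟨(1/2 : ℂ) • 1, by rw [smul_mul_assoc, one_mul]; ext i j; simp [Matrix.ofNat_apply, Matrix.one_apply],
      by rw [mul_smul_comm, mul_one]; ext i j; simp [Matrix.ofNat_apply, Matrix.one_apply]⟩
  have hinv := aux_inv C J Z P Q hJJ (hJd _) (hJd _) hZ1 hZ2 h1 h2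
  have hVV : (2 : ℂ) • cplx V = K * C * Kᵀ := by
    rw [hK, hC, ← cplx_transpose, ← cplx_mul, ← cplx_mul, hV]
    ext i j; simp [cplx]
  have hInv : ((2 : ℂ) • cplx V - J)⁻¹ = Tᵀ * ((1/2 : ℂ) • ((Z - 1) * J)) * T := by
    apply Matrix.inv_eq_right_inv
    calc _ = (K * (C - J) * Kᵀ) * (Tᵀ * ((1/2 : ℂ) • ((Z - 1) * J)) * T) := by
          rw [hVV]; nth_rewrite 1 [← hKJK]; noncomm_ring
      _ = K * ((C - J) * (Kᵀ * Tᵀ) * ((1/2 : ℂ) • ((Z - 1) * J))) * T := by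
          simp only [mul_assoc]
      _ = K * ((1/2 : ℂ) • ((C - J) * (Z - 1) * J)) * T := by
          rw [hKTT, mul_one, mul_smul_comm, mul_assoc (C - J)]
      _ = K * 1 * T := by
          rw [hinv]; congr 2
          ext i j; simp [Matrix.ofNat_apply, Matrix.one_apply]
      _ = 1 := by rw [mul_one, hKT]
  have hA : (2 * Complex.I) • (cplx H * W) = Tᵀ * (X * J) * Kᵀ := by
    have hX2 : X = (2 : ℂ) • cplx (pairDiag d) := by
      rw [hX, hcd, hcd]; ext i j
      by_cases h : i = j <;> simp [Matrix.diagonal_apply, h]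
    rw [mul_smul, ← mul_smul_comm, ← hJ, hH, cplx_mul, cplx_mul, cplx_transpose, hTS, hX2,
      mul_assoc _ T J, hTJ]
    simp only [mul_assoc, smul_mul_assoc, mul_smul_comm]
  have hAn : ∀ n : ℕ, (Tᵀ * (X * J) * Kᵀ) ^ n * J = Tᵀ * ((X * J) ^ n * J) * T := by
    intro n
    induction n with
    | zero => rw [pow_zero, pow_zero, one_mul, hTT, mul_assoc (J * K) J J, hJJ, mul_one,
        mul_assoc, hKT, mul_one]
    | succ k ih =>
      rw [pow_succ', mul_assoc, ih, pow_succ']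
      calc _ = Tᵀ * (X * J) * (Kᵀ * Tᵀ) * ((X * J) ^ k * J) * T := by simp only [mul_assoc]
        _ = _ := by rw [hKTT]; simp only [mul_assoc, mul_one]
  have hfin : ((2 : ℂ) • cplx V - J)⁻¹ -
        (1/2 : ℂ) •
          ((∑ n ∈ Finset.Icc 1 l,
              ((n.factorial : ℂ))⁻¹ • ((2 * Complex.I) • (cplx H * W)) ^ n) * J)
      = (1/2 : ℂ) • (Tᵀ * ((Z - 1 - ∑ n ∈ Finset.Icc 1 l, ((n.factorial : ℂ))⁻¹ • (X * J) ^ n) * J)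
          * T) := by
    rw [hInv, hA, Finset.sum_mul, sub_mul (Z - 1), mul_sub, sub_mul _ _ T, Finset.sum_mul,
      Finset.mul_sum, Finset.sum_mul, smul_sub, mul_smul_comm, smul_mul_assoc]
    congr 2
    refine Finset.sum_congr rfl fun n _ => ?_
    rw [smul_mul_assoc, hAn, smul_mul_assoc _ _ J, mul_smul_comm (n.factorial : ℂ)⁻¹, smul_mul_assoc (n.factorial : ℂ)⁻¹]
  have hXn : ‖X * J‖ ≤ 2 * dmax := by
    have : ‖X‖ ≤ 2 * dmax := by
      rw [hX, hcd, Matrix.l2_opNorm_diagonal]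
      refine (pi_norm_le_iff_of_nonneg (by positivity)).2 fun p => ?_
      rw [Complex.norm_real, Real.norm_eq_abs, abs_of_pos (by linarith [hd p.1])]
      linarith [hdmax_le p.1]
    calc _ ≤ ‖X‖ * ‖J‖ := norm_mul_le _ _
      _ ≤ (2 * dmax) * 1 := by gcongr
      _ = _ := mul_one _
  have hR := aux_remainder (X * J) (2 * dmax) hXn l
  rw [← hZ] at hR
  rw [hfin]
  set R := Z - 1 - ∑ n ∈ Finset.Icc 1 l, ((n.factorial : ℂ))⁻¹ • (X * J) ^ n with hRdef
  set r := (2 * dmax) ^ (l + 1) * Real.exp (2 * dmax) / ((l + 1).factorial : ℝ) with hr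
  have hr0 : 0 ≤ r := (norm_nonneg _).trans hR
  change ‖(1/2 : ℂ) • (Tᵀ * (R * J) * T)‖ ≤ _
  calc _ = (1/2) * ‖Tᵀ * (R * J) * T‖ := by rw [norm_smul]; norm_num
    _ ≤ (1/2) * (‖Tᵀ‖ * (‖R‖ * ‖J‖) * ‖T‖) := by
      gcongr
      refine (norm_mul_le _ _).trans ?_
      gcongr
      refine (norm_mul_le _ _).trans ?_
      gcongr
      exact norm_mul_le _ _
    _ ≤ (1/2) * (spNorm S * (r * 1) * spNorm S) := by gcongr
    _ = _ := by ring

end aux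

/-- Taylor-expansion bound: for every natural number `l`,
`‖(2V - iΩ)⁻¹ - (1/2)·(Σ_{n=1}^{l} (2H·iΩ)ⁿ/n!)·(iΩ)‖∞
  ≤ (‖S‖∞²/2)·(2 d_max)^{l+1}·e^{2 d_max}/(l+1)!`. -/
theorem statement4 {m : ℕ} (hm : 0 < m)
    (S : Matrix (Idx m) (Idx m) ℝ) (hS : S * Omega m * Sᵀ = Omega m)
    (d : Fin m → ℝ) (hd : ∀ i, 0 < d i)
    (dmax : ℝ) (hdmax_le : ∀ i, d i ≤ dmax) (hdmax_mem : ∃ i, d i = dmax)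
    (H : Matrix (Idx m) (Idx m) ℝ) (hH : H = (S⁻¹)ᵀ * pairDiag d * S⁻¹)
    (V : Matrix (Idx m) (Idx m) ℝ)
    (hV : V = (1/2 : ℝ) • (S * pairDiag (fun i => rcoth (d i)) * Sᵀ))
    (l : ℕ) :
    spNorm (((2 : ℂ) • cplx V - Complex.I • cplx (Omega m))⁻¹ -
        (1/2 : ℂ) •
          ((∑ n ∈ Finset.Icc 1 l,
              ((n.factorial : ℂ))⁻¹ • ((2 * Complex.I) • (cplx H * cplx (Omega m))) ^ n) *
            (Complex.I • cplx (Omega m))))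
      ≤ (spNorm S ^ 2 / 2) *
          ((2 * dmax) ^ (l + 1) * Real.exp (2 * dmax) / ((l + 1).factorial : ℝ)) := by
  exact statement4_aux hm S hS d hd dmax hdmax_le hdmax_mem H hH V hV l
end

section
/- Let M be a 2m×2m positive definite Hermitian matrix, 𝒩 = (𝒩_i)_{i=1}^m a neighborhood structure on {1,…,m}, and E a Hermitian 2m×2m matrix such that LOC_𝒩(M − E) = M − E. For each i ∈ {1,…,m} and δ ∈ {0,1} let B_{i,δ} be the off-diagonal block of M associated with (𝒩, i, δ) and B̃_{i,δ} the same block with its first row replaced by zeros. Then ‖M − LI_𝒩(M⁻¹)‖∞ ≤ 2·max_{i∈{1,…,m}, δ∈{0,1}} (|𝒩_i|·‖B_{i,δ} − B̃_{i,δ}‖∞) · ‖M⁻¹‖∞ · ‖M‖∞ + (2·max_i |𝒩_i| + 1)·‖E‖∞. -/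
open Matrix
open scoped ComplexOrder

/-- `LOC_𝒩(M)`: keep the entries of `M` indexed by the neighborhood structure `𝒩`,
set all other entries to `0`. -/
def locMat {m : ℕ} (𝒩 : Fin m → Finset (Fin m))
    (M : Matrix (Idx m) (Idx m) ℂ) : Matrix (Idx m) (Idx m) ℂ :=
  Matrix.of fun p q => if q.1 ∈ 𝒩 p.1 then M p q else 0

/-- The principal submatrix `N_i` of `N` on the rows and columns
`{(j, δ) : j ∈ 𝒩 i, δ ∈ {0,1}}`. -/
def nbhdSub {m : ℕ} (𝒩 : Fin m → Finset (Fin m))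
    (N : Matrix (Idx m) (Idx m) ℂ) (i : Fin m) :
    Matrix (↥(𝒩 i) × Fin 2) (↥(𝒩 i) × Fin 2) ℂ :=
  N.submatrix (fun a => ((a.1 : Fin m), a.2)) (fun a => ((a.1 : Fin m), a.2))

/-- The local inversion `LI_𝒩(N)`: for `j ∈ 𝒩 i`,
`(LI_𝒩(N))_{(i,δ),(j,δ')} = (1/2)·[(N_i⁻¹)_{(i,δ),(j,δ')} + conj((N_j⁻¹)_{(j,δ'),(i,δ)})]`,
and all other entries are `0`. -/
noncomputable def locInv {m : ℕ} (𝒩 : Fin m → Finset (Fin m))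
    (N : Matrix (Idx m) (Idx m) ℂ) : Matrix (Idx m) (Idx m) ℂ :=
  Matrix.of fun p q =>
    if h : p.1 ∈ 𝒩 p.1 ∧ q.1 ∈ 𝒩 p.1 ∧ p.1 ∈ 𝒩 q.1 ∧ q.1 ∈ 𝒩 q.1 then
      (1/2 : ℂ) *
        (((nbhdSub 𝒩 N p.1)⁻¹) (⟨p.1, h.1⟩, p.2) (⟨q.1, h.2.1⟩, q.2) +
          star (((nbhdSub 𝒩 N q.1)⁻¹) (⟨q.1, h.2.2.2⟩, q.2) (⟨p.1, h.2.2.1⟩, p.2)))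
    else 0

/-- The off-diagonal block `B_{i,δ}` of `M` associated with `(𝒩, i, δ)`: rows indexed by
`{(j, δ') : j ∈ 𝒩 i}`, columns indexed by the complementary indices `{(j, δ') : j ∉ 𝒩 i}`
(the permutation `π_{i,δ}` merely relabels these index sets, leaving the spectral norm
unchanged; the "first row" is the row of index `(i, δ)`). -/
def offBlock {m : ℕ} (𝒩 : Fin m → Finset (Fin m))
    (M : Matrix (Idx m) (Idx m) ℂ) (i : Fin m) :
    Matrix (↥(𝒩 i) × Fin 2) {q : Idx m // q.1 ∉ 𝒩 i} ℂ :=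
  Matrix.of fun a b => M ((a.1 : Fin m), a.2) b.1

/-- `B̃_{i,δ}`: the off-diagonal block `B_{i,δ}` with its first row (the row of index
`(i, δ)`) replaced by zeros. -/
def offBlockTilde {m : ℕ} (𝒩 : Fin m → Finset (Fin m))
    (M : Matrix (Idx m) (Idx m) ℂ) (i : Fin m) (δ : Fin 2) :
    Matrix (↥(𝒩 i) × Fin 2) {q : Idx m // q.1 ∉ 𝒩 i} ℂ :=
  Matrix.of fun a b => if (a.1 : Fin m) = i ∧ a.2 = δ then 0 else M ((a.1 : Fin m), a.2) b.1

section LIBound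

open scoped Matrix.Norms.L2Operator MatrixOrder

lemma spNorm_eq {p q : Type*} [Fintype p] [Fintype q] [DecidableEq q] (A : Matrix p q ℂ) :
    spNorm A = ‖A‖ := rfl

lemma nsq_mulVec_le {p q : Type*} [Fintype p] [Fintype q] [DecidableEq q] (A : Matrix p q ℂ)
    (v : q → ℂ) : ∑ i, ‖(A *ᵥ v) i‖ ^ 2 ≤ ‖A‖ ^ 2 * ∑ j, ‖v j‖ ^ 2 := by
  have h := l2_opNorm_mulVec A (WithLp.toLp 2 v)
  have h2 := pow_le_pow_left₀ (norm_nonneg _) h 2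
  rw [mul_pow, EuclideanSpace.norm_sq_eq, EuclideanSpace.norm_sq_eq] at h2
  exact h2

lemma norm_le_of_nsq {p q : Type*} [Fintype p] [Fintype q] [DecidableEq q] (A : Matrix p q ℂ)
    (R : ℝ) (hR : 0 ≤ R)
    (h : ∀ v : q → ℂ, ∑ i, ‖(A *ᵥ v) i‖ ^ 2 ≤ R ^ 2 * ∑ j, ‖v j‖ ^ 2) : ‖A‖ ≤ R := by
  rw [l2_opNorm_def]
  refine ContinuousLinearMap.opNorm_le_bound _ hR fun x => ?_
  refine (sq_le_sq₀ (by positivity) (by positivity)).mp ?_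
  rw [mul_pow, EuclideanSpace.norm_sq_eq, EuclideanSpace.norm_sq_eq]
  exact h x.ofLp

lemma nsq_col_le {p q : Type*} [Fintype p] [Fintype q] [DecidableEq q] (A : Matrix p q ℂ)
    (j : q) : ∑ i, ‖A i j‖ ^ 2 ≤ ‖A‖ ^ 2 := by
  have h := nsq_mulVec_le A (Pi.single j 1)
  have h1 : ∑ k, ‖(Pi.single j 1 : q → ℂ) k‖ ^ 2 = 1 := by
    rw [Finset.sum_eq_single j] <;> simp +contextual
  rw [h1, mul_one] at h
  simpa using h

lemma nsq_row_le {p q : Type*} [Fintype p] [Fintype q] [DecidableEq q] [DecidableEq p]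
    (A : Matrix p q ℂ) (i : p) : ∑ j, ‖A i j‖ ^ 2 ≤ ‖A‖ ^ 2 := by
  have h := nsq_col_le Aᴴ i
  rw [l2_opNorm_conjTranspose] at h
  simpa using h

lemma sparse_bound {m : ℕ} (𝒩 : Fin m → Finset (Fin m)) (hsym : ∀ i j, i ∈ 𝒩 j ↔ j ∈ 𝒩 i)
    (d : ℝ) (hd : ∀ i, ((𝒩 i).card : ℝ) ≤ d)
    (A : Matrix (Idx m) (Idx m) ℂ) (hA : ∀ p q, q.1 ∉ 𝒩 p.1 → A p q = 0)
    (r R : ℝ) (hr : 0 ≤ r) (hR : 0 ≤ R) (hrow : ∀ p, ∑ q, ‖A p q‖ ^ 2 ≤ r)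
    (hrR : 2 * d * r ≤ R ^ 2) : ‖A‖ ≤ R := by
  refine norm_le_of_nsq A R hR fun v => ?_
  have h1 : ∀ p, ‖(A *ᵥ v) p‖ ^ 2 ≤ r * ∑ q : Idx m, if q.1 ∈ 𝒩 p.1 then ‖v q‖ ^ 2 else 0 := by
    intro p
    have e : ‖(A *ᵥ v) p‖ ≤ ∑ q : Idx m, ‖A p q‖ * (if q.1 ∈ 𝒩 p.1 then ‖v q‖ else 0) := by
      refine (norm_sum_le _ _).trans (Finset.sum_le_sum fun q _ => ?_)
      by_cases h : q.1 ∈ 𝒩 p.1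
      · simp [h]
      · simp [h, hA p q h]
    calc ‖(A *ᵥ v) p‖ ^ 2
        ≤ (∑ q : Idx m, ‖A p q‖ * (if q.1 ∈ 𝒩 p.1 then ‖v q‖ else 0)) ^ 2 :=
          pow_le_pow_left₀ (norm_nonneg _) e 2
      _ ≤ (∑ q : Idx m, ‖A p q‖ ^ 2) * ∑ q : Idx m, (if q.1 ∈ 𝒩 p.1 then ‖v q‖ else 0) ^ 2 :=
          Finset.sum_mul_sq_le_sq_mul_sq _ _ _
      _ ≤ r * ∑ q : Idx m, (if q.1 ∈ 𝒩 p.1 then ‖v q‖ else 0) ^ 2 :=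
          mul_le_mul_of_nonneg_right (hrow p) (Finset.sum_nonneg fun _ _ => by positivity)
      _ = _ := by
          congr 1
          refine Finset.sum_congr rfl fun q _ => ?_
          split_ifs <;> simp
  have h2 : ∀ q : Idx m, (∑ p : Idx m, if q.1 ∈ 𝒩 p.1 then ‖v q‖ ^ 2 else 0)
      ≤ 2 * d * ‖v q‖ ^ 2 := by
    intro q
    have : (∑ p : Idx m, if q.1 ∈ 𝒩 p.1 then ‖v q‖ ^ 2 else 0)
        = 2 * ((𝒩 q.1).card : ℝ) * ‖v q‖ ^ 2 := by
      rw [Fintype.sum_prod_type]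
      simp only [hsym q.1, Finset.sum_const, Finset.card_univ, Fintype.card_fin]
      rw [← Finset.smul_sum]
      simp
      ring
    rw [this]
    have := hd q.1
    gcongr
  calc ∑ p, ‖(A *ᵥ v) p‖ ^ 2
      ≤ ∑ p : Idx m, r * ∑ q : Idx m, if q.1 ∈ 𝒩 p.1 then ‖v q‖ ^ 2 else 0 :=
        Finset.sum_le_sum fun p _ => h1 p
    _ = r * ∑ q : Idx m, ∑ p : Idx m, if q.1 ∈ 𝒩 p.1 then ‖v q‖ ^ 2 else 0 := by
        rw [← Finset.mul_sum, Finset.sum_comm]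
    _ ≤ r * ∑ q : Idx m, 2 * d * ‖v q‖ ^ 2 := by
        gcongr with q _; exact h2 q
    _ = (2 * d * r) * ∑ q, ‖v q‖ ^ 2 := by rw [← Finset.mul_sum]; ring
    _ ≤ _ := by gcongr

lemma dot_self {n : Type*} [Fintype n] (u : n → ℂ) :
    star u ⬝ᵥ u = ((∑ i, ‖u i‖ ^ 2 : ℝ) : ℂ) := by
  simp only [dotProduct, Pi.star_apply, RCLike.star_def, Complex.conj_mul']
  push_cast
  rfl

lemma dot_le {n : Type*} [Fintype n] (u w : n → ℂ) :
    ‖star u ⬝ᵥ w‖ ^ 2 ≤ (∑ i, ‖u i‖ ^ 2) * ∑ i, ‖w i‖ ^ 2 := by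
  have e : ‖star u ⬝ᵥ w‖ ≤ ∑ i, ‖u i‖ * ‖w i‖ := by
    refine (norm_sum_le _ _).trans (Finset.sum_le_sum fun q _ => ?_)
    simp
  exact (pow_le_pow_left₀ (norm_nonneg _) e 2).trans (Finset.sum_mul_sq_le_sq_mul_sq _ _ _)

lemma core_bound {n : Type*} [Fintype n] [DecidableEq n] (M : Matrix n n ℂ) (hM : M.PosDef)
    (v w : n → ℂ) (hw : ∀ q, v q ≠ 0 → (M *ᵥ v) q = w q) :
    ∑ q, ‖(M *ᵥ v) q‖ ^ 2 ≤ ‖M‖ * ‖M⁻¹‖ * ∑ q, ‖w q‖ ^ 2 := by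
  obtain ⟨S, hS⟩ := CStarAlgebra.nonneg_iff_eq_star_mul_self.mp hM.posSemidef.nonneg
  rw [star_eq_conjTranspose] at hS
  have hdet : IsUnit M.det := (Matrix.isUnit_iff_isUnit_det M).mp hM.isUnit
  have hS1 : ‖M‖ = ‖Sᴴ‖ ^ 2 := by
    rw [l2_opNorm_conjTranspose, hS, l2_opNorm_conjTranspose_mul_self, sq]
  have hS2 : ‖M⁻¹‖ = ‖M⁻¹ * Sᴴ‖ ^ 2 := by
    have h := l2_opNorm_conjTranspose_mul_self (M⁻¹ * Sᴴ)ᴴ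
    rw [conjTranspose_conjTranspose, l2_opNorm_conjTranspose, conjTranspose_mul,
      conjTranspose_conjTranspose, hM.isHermitian.inv.eq] at h
    rw [sq, ← h, Matrix.mul_assoc, ← Matrix.mul_assoc Sᴴ, ← hS, Matrix.mul_nonsing_inv _ hdet,
      Matrix.mul_one]
  set a := ∑ i, ‖(S *ᵥ v) i‖ ^ 2 with ha
  set b := ∑ q, ‖w q‖ ^ 2 with hb
  set c := ∑ q, ‖v q‖ ^ 2 with hc
  have ha0 : 0 ≤ a := Finset.sum_nonneg fun _ _ => by positivity
  have hb0 : 0 ≤ b := Finset.sum_nonneg fun _ _ => by positivity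
  have h1 : ∑ q, ‖(M *ᵥ v) q‖ ^ 2 ≤ ‖M‖ * a := by
    have := nsq_mulVec_le Sᴴ (S *ᵥ v)
    rw [mulVec_mulVec, ← hS, ← hS1] at this
    exact this
  have h2 : c ≤ ‖M⁻¹‖ * a := by
    have := nsq_mulVec_le (M⁻¹ * Sᴴ) (S *ᵥ v)
    rw [mulVec_mulVec, Matrix.mul_assoc, ← hS, Matrix.nonsing_inv_mul _ hdet, one_mulVec, ← hS2]
      at this
    exact this
  have h3 : (a : ℂ) = star v ⬝ᵥ w := by
    have e1 : (a : ℂ) = star v ⬝ᵥ (M *ᵥ v) := by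
      rw [ha, ← dot_self, star_mulVec, ← dotProduct_mulVec, mulVec_mulVec, ← hS]
    rw [e1]
    refine Finset.sum_congr rfl fun q _ => ?_
    by_cases h : v q = 0
    · simp [h]
    · rw [hw q h]
  have h4 : a ^ 2 ≤ c * b := by
    have := dot_le v w
    rw [← h3] at this
    simpa using this
  have h5 : a ≤ ‖M⁻¹‖ * b := by
    rcases ha0.eq_or_lt with h | h
    · rw [← h]; positivity
    · have : a * a ≤ (‖M⁻¹‖ * b) * a := by nlinarith [mul_le_mul_of_nonneg_right h2 hb0]
      exact le_of_mul_le_mul_right this h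
  calc _ ≤ ‖M‖ * a := h1
    _ ≤ ‖M‖ * (‖M⁻¹‖ * b) := by gcongr
    _ = _ := by ring

/-- The column `p` of the inverse of the neighbourhood submatrix, extended by zero. -/
noncomputable def gcol {m : ℕ} (𝒩 : Fin m → Finset (Fin m)) (hself : ∀ i, i ∈ 𝒩 i)
    (N : Matrix (Idx m) (Idx m) ℂ) (p : Idx m) : Idx m → ℂ := fun q =>
  if h : q.1 ∈ 𝒩 p.1 then (nbhdSub 𝒩 N p.1)⁻¹ (⟨q.1, h⟩, q.2) (⟨p.1, hself p.1⟩, p.2) else 0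

lemma nbhdSub_posDef {m : ℕ} (𝒩 : Fin m → Finset (Fin m)) (N : Matrix (Idx m) (Idx m) ℂ)
    (hN : N.PosDef) (i : Fin m) : (nbhdSub 𝒩 N i).PosDef := by
  refine hN.submatrix ?_
  rintro ⟨⟨a, ha⟩, b⟩ ⟨⟨c, hc⟩, d⟩ h
  simp at h
  simp [h]

lemma gcol_mul {m : ℕ} (𝒩 : Fin m → Finset (Fin m)) (hself : ∀ i, i ∈ 𝒩 i)
    (N : Matrix (Idx m) (Idx m) ℂ) (hN : N.PosDef) (p q : Idx m) (hq : q.1 ∈ 𝒩 p.1) :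
    (N *ᵥ gcol 𝒩 hself N p) q = (Pi.single p 1 : Idx m → ℂ) q := by
  have hu := (Matrix.isUnit_iff_isUnit_det _).mp (nbhdSub_posDef 𝒩 N hN p.1).isUnit
  have h := congrFun (congrFun (Matrix.mul_nonsing_inv _ hu) (⟨q.1, hq⟩, q.2))
    (⟨p.1, hself p.1⟩, p.2)
  have e : (Pi.single p 1 : Idx m → ℂ) q =
      (1 : Matrix (↥(𝒩 p.1) × Fin 2) (↥(𝒩 p.1) × Fin 2) ℂ) (⟨q.1, hq⟩, q.2)
        (⟨p.1, hself p.1⟩, p.2) := by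
    rw [Matrix.one_apply, Pi.single_apply]
    congr 1
    simp [Prod.ext_iff]
  rw [e, ← h, Matrix.mul_apply]
  simp only [mulVec, dotProduct]
  rw [Fintype.sum_prod_type, Fintype.sum_prod_type, ← Finset.sum_subset (Finset.subset_univ (𝒩 p.1)),
    ← Finset.sum_coe_sort]
  · refine Finset.sum_congr rfl fun j _ => Finset.sum_congr rfl fun δ _ => ?_
    simp [gcol, nbhdSub]
  · intro j _ hj
    simp [gcol, hj]

lemma col_bound {m : ℕ} (𝒩 : Fin m → Finset (Fin m)) (hself : ∀ i, i ∈ 𝒩 i)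
    (M : Matrix (Idx m) (Idx m) ℂ) (hM : M.PosDef) (p : Idx m) :
    ∑ q, ‖gcol 𝒩 hself M⁻¹ p q - M q p‖ ^ 2 ≤
      ‖M‖ * ‖M⁻¹‖ * ∑ q : Idx m, if q.1 ∈ 𝒩 p.1 then 0 else ‖M q p‖ ^ 2 := by
  have hdet : IsUnit M.det := (Matrix.isUnit_iff_isUnit_det M).mp hM.isUnit
  set z : Idx m → ℂ := M⁻¹ *ᵥ gcol 𝒩 hself M⁻¹ p - Pi.single p 1 with hz
  have hMz : ∀ q, (M *ᵥ z) q = gcol 𝒩 hself M⁻¹ p q - M q p := by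
    intro q
    rw [hz, mulVec_sub, mulVec_mulVec, Matrix.mul_nonsing_inv _ hdet, one_mulVec]
    simp
  have := core_bound M hM z (fun q => if q.1 ∈ 𝒩 p.1 then 0 else - M q p) (by
    intro q hq
    have : q.1 ∉ 𝒩 p.1 := by
      intro h
      apply hq
      rw [hz, Pi.sub_apply, gcol_mul 𝒩 hself _ hM.inv p q h, sub_self]
    rw [hMz]
    simp [this, gcol])
  simp only [hMz] at this
  refine this.trans (le_of_eq ?_)
  congr 1
  refine Finset.sum_congr rfl fun q _ => ?_
  split_ifs <;> simp

lemma off_bound {m : ℕ} (𝒩 : Fin m → Finset (Fin m)) (hself : ∀ i, i ∈ 𝒩 i)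
    (M : Matrix (Idx m) (Idx m) ℂ) (hM : M.IsHermitian) (p : Idx m) :
    (∑ q : Idx m, if q.1 ∈ 𝒩 p.1 then 0 else ‖M q p‖ ^ 2) ≤
      ‖offBlock 𝒩 M p.1 - offBlockTilde 𝒩 M p.1 p.2‖ ^ 2 := by
  refine le_trans (le_of_eq ?_) (nsq_row_le _ (⟨p.1, hself p.1⟩, p.2))
  simp only [Matrix.sub_apply, offBlock, offBlockTilde, Matrix.of_apply, and_self, if_true,
    sub_zero]
  rw [← Finset.sum_subtype (Finset.univ.filter fun q : Idx m => q.1 ∉ 𝒩 p.1) (by simp)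
    (fun q => ‖M p q‖ ^ 2), Finset.sum_filter]
  refine Finset.sum_congr rfl fun q _ => ?_
  rw [← hM.apply p q, norm_star]
  by_cases h : q.1 ∈ 𝒩 p.1 <;> simp [h]

lemma main_bound {m : ℕ} (hm : 0 < m)
    (M E : Matrix (Idx m) (Idx m) ℂ)
    (hMpd : M.PosDef)
    (𝒩 : Fin m → Finset (Fin m))
    (hself : ∀ i, i ∈ 𝒩 i) (hsym : ∀ i j, i ∈ 𝒩 j ↔ j ∈ 𝒩 i)
    (hloc : locMat 𝒩 (M - E) = M - E) :
    ‖M - locInv 𝒩 M⁻¹‖ ≤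
      2 * (⨆ p : Idx m, ((𝒩 p.1).card : ℝ) *
            ‖offBlock 𝒩 M p.1 - offBlockTilde 𝒩 M p.1 p.2‖) *
          ‖M⁻¹‖ * ‖M‖
        + (2 * (⨆ i : Fin m, ((𝒩 i).card : ℝ)) + 1) * ‖E‖ := by
  have hd : ∀ i, ((𝒩 i).card : ℝ) ≤ ⨆ i : Fin m, ((𝒩 i).card : ℝ) :=
    fun i => le_ciSup (f := fun i => ((𝒩 i).card : ℝ)) (Set.finite_range _).bddAbove i
  have hK : ∀ p : Idx m, ((𝒩 p.1).card : ℝ) *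
      ‖offBlock 𝒩 M p.1 - offBlockTilde 𝒩 M p.1 p.2‖ ≤ ⨆ p : Idx m, ((𝒩 p.1).card : ℝ) *
            ‖offBlock 𝒩 M p.1 - offBlockTilde 𝒩 M p.1 p.2‖ :=
    fun p => le_ciSup (f := fun p : Idx m => ((𝒩 p.1).card : ℝ) *
            ‖offBlock 𝒩 M p.1 - offBlockTilde 𝒩 M p.1 p.2‖) (Set.finite_range _).bddAbove p
  generalize (⨆ i : Fin m, ((𝒩 i).card : ℝ)) = d at hd ⊢
  generalize (⨆ p : Idx m, ((𝒩 p.1).card : ℝ) *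
            ‖offBlock 𝒩 M p.1 - offBlockTilde 𝒩 M p.1 p.2‖) = K at hK ⊢
  have hcard : ∀ i, (1 : ℝ) ≤ ((𝒩 i).card : ℝ) := fun i => by
    exact_mod_cast Finset.card_pos.mpr ⟨i, hself i⟩
  have hd1 : 1 ≤ d := (hcard ⟨0, hm⟩).trans (hd _)
  have hK' : ∀ p : Idx m, ‖offBlock 𝒩 M p.1 - offBlockTilde 𝒩 M p.1 p.2‖ ≤ K := fun p =>
    (le_mul_of_one_le_left (norm_nonneg _) (hcard p.1)).trans (hK p)
  have hK0 : 0 ≤ K := (norm_nonneg _).trans (hK' (⟨0, hm⟩, 0))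
  have hEM : ∀ p q : Idx m, q.1 ∉ 𝒩 p.1 → M p q = E p q := by
    intro p q h
    have := congrFun (congrFun hloc p) q
    simp only [locMat, Matrix.of_apply, h, if_false, Matrix.sub_apply] at this
    exact (sub_eq_zero.mp this.symm)
  have he0 : 0 ≤ ‖E‖ := norm_nonneg _
  have hbeta : ∀ p : Idx m, (∑ q : Idx m, if q.1 ∈ 𝒩 p.1 then 0 else ‖M q p‖ ^ 2) ≤ ‖E‖ * K := by
    intro p
    have h0 : 0 ≤ (∑ q : Idx m, if q.1 ∈ 𝒩 p.1 then 0 else ‖M q p‖ ^ 2) :=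
      Finset.sum_nonneg fun q _ => by split_ifs <;> positivity
    have h1 := (off_bound 𝒩 hself M hMpd.isHermitian p).trans
      (pow_le_pow_left₀ (norm_nonneg _) (hK' p) 2)
    have h2 : (∑ q : Idx m, if q.1 ∈ 𝒩 p.1 then 0 else ‖M q p‖ ^ 2) ≤ ‖E‖ ^ 2 := by
      refine (Finset.sum_le_sum fun q _ => ?_).trans (nsq_col_le E p)
      split_ifs with h
      · positivity
      · rw [hEM q p (fun h' => h ((hsym _ _).mp h'))]
    refine abs_le_of_sq_le_sq' ?_ (by positivity) |>.2
    calc _ ≤ ‖E‖ ^ 2 * K ^ 2 := by rw [sq]; gcongr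
      _ = _ := by ring
  set Y : Matrix (Idx m) (Idx m) ℂ := Matrix.of fun q p =>
    if q.1 ∈ 𝒩 p.1 then M q p - gcol 𝒩 hself M⁻¹ p q else 0 with hY
  have hYb : ‖Yᴴ‖ ≤ ‖M‖ * ‖M⁻¹‖ * K + d * ‖E‖ / 2 := by
    refine sparse_bound 𝒩 hsym d hd _ ?_ (‖M‖ * ‖M⁻¹‖ * (‖E‖ * K)) _ (by positivity)
      (by positivity) ?_ ?_
    · intro p q h
      simp [hY, h]
    · intro p
      refine le_trans ?_ ((col_bound 𝒩 hself M hMpd p).trans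
        (mul_le_mul_of_nonneg_left (hbeta p) (by positivity)))
      refine Finset.sum_le_sum fun q _ => ?_
      simp only [hY, conjTranspose_apply, norm_star, Matrix.of_apply]
      split_ifs
      · rw [norm_sub_rev]
      · simp
    · nlinarith [sq_nonneg (‖M‖ * ‖M⁻¹‖ * K - d * ‖E‖ / 2)]
  have hLb : ‖locMat 𝒩 E‖ ≤ 3 / 2 * d * ‖E‖ := by
    refine sparse_bound 𝒩 hsym d hd _ ?_ (‖E‖ ^ 2) _ (by positivity)
      (by positivity) ?_ ?_
    · intro p q h
      simp [locMat, h]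
    · intro p
      refine le_trans (Finset.sum_le_sum fun q _ => ?_) (nsq_row_le E p)
      simp only [locMat, Matrix.of_apply]
      split_ifs
      · exact le_rfl
      · simp
    · have : 2 * d ≤ 9 / 4 * d ^ 2 := by nlinarith
      nlinarith [mul_le_mul_of_nonneg_right this (sq_nonneg ‖E‖)]
  have hdecomp : M - locInv 𝒩 M⁻¹ = (1 / 2 : ℂ) • (Y + Yᴴ) + (E - locMat 𝒩 E) := by
    ext p q
    simp only [Matrix.sub_apply, Matrix.add_apply, Matrix.smul_apply, conjTranspose_apply, hY,
      locMat, locInv, Matrix.of_apply, smul_eq_mul, hsym p.1 q.1]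
    by_cases h : q.1 ∈ 𝒩 p.1
    · have h' := (hsym _ _).mp h
      have hG := (nbhdSub_posDef 𝒩 M⁻¹ hMpd.inv p.1).isHermitian.inv
      have hG' := (nbhdSub_posDef 𝒩 M⁻¹ hMpd.inv q.1).isHermitian.inv
      simp only [h, h', hself, and_self, dite_true, if_true, gcol, star_sub, hG.apply, hG'.apply,
        hMpd.isHermitian.apply]
      ring
    · simp [h, hEM p q h]
  have hfin : ‖M - locInv 𝒩 M⁻¹‖ ≤ ‖Yᴴ‖ + (‖E‖ + ‖locMat 𝒩 E‖) := by
    rw [hdecomp]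
    refine (norm_add_le _ _).trans (add_le_add ?_ (norm_sub_le _ _))
    rw [norm_smul]
    have := norm_add_le Y Yᴴ
    rw [l2_opNorm_conjTranspose] at this ⊢
    norm_num
    linarith
  have hp : 0 ≤ ‖M‖ * ‖M⁻¹‖ * K := by positivity
  nlinarith

end LIBound

/-- Local inversion bound: for a positive definite Hermitian `M`, a
neighborhood structure `𝒩`, and Hermitian `E` with `LOC_𝒩(M - E) = M - E`,
`‖M - LI_𝒩(M⁻¹)‖∞ ≤ 2·max_{i,δ}(|𝒩_i|·‖B_{i,δ} - B̃_{i,δ}‖∞)·‖M⁻¹‖∞·‖M‖∞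
  + (2·max_i |𝒩_i| + 1)·‖E‖∞`. -/
theorem statement9 {m : ℕ} (hm : 0 < m)
    (M E : Matrix (Idx m) (Idx m) ℂ)
    (hMpd : M.PosDef) (hE : E.IsHermitian)
    (𝒩 : Fin m → Finset (Fin m))
    (hself : ∀ i, i ∈ 𝒩 i) (hsym : ∀ i j, i ∈ 𝒩 j ↔ j ∈ 𝒩 i)
    (hloc : locMat 𝒩 (M - E) = M - E) :
    spNorm (M - locInv 𝒩 M⁻¹) ≤
      2 * (⨆ p : Idx m, ((𝒩 p.1).card : ℝ) *
            spNorm (offBlock 𝒩 M p.1 - offBlockTilde 𝒩 M p.1 p.2)) *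
          spNorm M⁻¹ * spNorm M
        + (2 * (⨆ i : Fin m, ((𝒩 i).card : ℝ)) + 1) * spNorm E := by
  exact main_bound hm M E hMpd 𝒩 hself hsym hloc
end
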